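/- There exists a Hermitian 12×12 matrix K₀, partitioned into nine 4×4 blocks with K₀_B = 0 and K₀_A = 0, that is not of the form (U⊗V)Z(U⊗V)† for any U ∈ SU(3), V ∈ SU(4), and any Z in the space of such Hermitian matrices with all three diagonal 4×4 blocks diagonal. (Dimension count: dim(SU(3)×SU(4)×D₀₀) = 8+15+96 = 119 < 120 = dim M₀₀, so the smooth map f(X,Y,Z)=(X⊗Y)Z(X⊗Y)† is not onto.) -/

import Mathlib

noncomputable section

open Matrix Kronecker

/-- Sum of the three diagonal 4×4 blocks of a 12×12 matrix. -/
def blockB' (M : Matrix (Fin 3 × Fin 4) (Fin 3 × Fin 4) ℂ) : Matrix (Fin 4) (Fin 4) ℂ :=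
  Matrix.of fun a b => ∑ i : Fin 3, M (i, a) (i, b)

/-- The 3×3 matrix of traces of the 4×4 blocks of a 12×12 matrix. -/
def blockA' (M : Matrix (Fin 3 × Fin 4) (Fin 3 × Fin 4) ℂ) : Matrix (Fin 3) (Fin 3) ℂ :=
  Matrix.of fun i j => ∑ a : Fin 4, M (i, a) (j, a)

/-- A 12×12 matrix is a dd-matrix if its three diagonal 4×4 blocks are diagonal. -/
def IsDD' (M : Matrix (Fin 3 × Fin 4) (Fin 3 × Fin 4) ℂ) : Prop :=
  ∀ (i : Fin 3) (a b : Fin 4), a ≠ b → M (i, a) (i, b) = 0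

namespace Stmt11

/-- Hermitian matrix with given real coordinates. -/
def herm {n : Type} (s : n × n → ℝ) : Matrix n n ℂ :=
  Matrix.of fun p q => ((s (p, q) + s (q, p) : ℝ) : ℂ) + ((s (p, q) - s (q, p) : ℝ) : ℂ) * Complex.I

/-- Real coordinates of a matrix, inverse to `herm` on Hermitian matrices. -/
def coord {n : Type} (M : Matrix n n ℂ) : n × n → ℝ :=
  fun x => ((M x.1 x.2).re + (M x.1 x.2).im) / 2

lemma herm_isHermitian {n : Type} (s : n × n → ℝ) : (herm s).IsHermitian := by
  ext p q
  apply Complex.ext <;> simp [herm] <;> ring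

lemma coord_herm {n : Type} (s : n × n → ℝ) : coord (herm s) = s := by
  ext ⟨p, q⟩
  simp [herm, coord]

lemma herm_coord {n : Type} {M : Matrix n n ℂ} (h : M.IsHermitian) : herm (coord M) = M := by
  ext p q
  have h1 := congrArg Complex.re (h.apply p q)
  have h2 := congrArg Complex.im (h.apply p q)
  simp at h1 h2
  apply Complex.ext <;> simp [herm, coord] <;> linarith

/-- Numerator of the Cayley transform. -/
def cay {n : Type} [Fintype n] [DecidableEq n] (H : Matrix n n ℂ) : Matrix n n ℂ :=
  (1 - Complex.I • H) * adjugate (1 + Complex.I • H)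

lemma exists_phase {n : Type} [Fintype n] [DecidableEq n] (U : Matrix n n ℂ) :
    ∃ z : ℂ, z * star z = 1 ∧ IsUnit (z • 1 + U).det := by
  have hinf : (Metric.sphere (0 : ℂ) 1).Infinite := by
    have : (Set.range fun x : ℝ => Complex.exp (x * Complex.I)) = Metric.sphere (0 : ℂ) 1 := by
      simp
    intro hf
    have hc : (Metric.sphere (0:ℂ) 1).Countable := hf.countable
    have : Cardinal.mk (Set.Ioc (-Real.pi) Real.pi) ≤ Cardinal.mk (Metric.sphere (0:ℂ) 1) := by
      refine Cardinal.mk_le_of_injective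
        (f := fun x => ⟨Complex.exp (x.1 * Complex.I), by simp⟩) ?_
      intro x y hxy
      simp only [Subtype.mk.injEq] at hxy
      have := congrArg Complex.arg hxy
      rw [Complex.arg_exp_mul_I, Complex.arg_exp_mul_I] at this
      rw [(toIocMod_eq_self _).2, (toIocMod_eq_self _).2] at this
      · exact Subtype.ext this
      · have := y.2; simp only [Set.mem_Ioc] at this ⊢; constructor <;> linarith
      · have := x.2; simp only [Set.mem_Ioc] at this ⊢; constructor <;> linarith
    rw [Cardinal.mk_Ioc_real (by linarith [Real.pi_pos])] at this
    have h2 := hf.lt_aleph0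
    exact absurd (this.trans_lt h2) (not_lt.2 Cardinal.aleph0_le_continuum)
  have hfin : {z : ℂ | (-U).charpoly.IsRoot z}.Finite :=
    Polynomial.finite_setOfPred_isRoot ((-U).charpoly_monic.ne_zero)
  obtain ⟨z, hz, hz2⟩ := (hinf.sdiff hfin).nonempty
  refine ⟨z, ?_, ?_⟩
  · rw [Complex.star_def, Complex.mul_conj, Complex.normSq_eq_norm_sq]
    simp at hz
    simp [hz]
  · simp only [Set.mem_ofPred_eq, Polynomial.IsRoot, Matrix.eval_charpoly] at hz2
    rw [isUnit_iff_ne_zero]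
    convert hz2 using 3
    rw [sub_neg_eq_add, Matrix.smul_one_eq_diagonal]
    rfl

lemma exists_cay {n : Type} [Fintype n] [DecidableEq n] (U : Matrix n n ℂ)
    (hU : U * Uᴴ = 1) : ∃ (c : ℂ) (H : Matrix n n ℂ), H.IsHermitian ∧ U = c • cay H := by
  obtain ⟨z, hz, hd⟩ := exists_phase U
  have hz' : star z * z = 1 := by rw [mul_comm]; exact hz
  set U1 := star z • U with hU1
  have hUU : U1 * U1ᴴ = 1 := by
    simp only [hU1, conjTranspose_smul, star_star, smul_mul_assoc, mul_smul_comm, smul_smul, hU]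
    rw [hz, one_smul]
  have hUU' : U1ᴴ * U1 = 1 := mul_eq_one_comm.1 hUU
  have hP : IsUnit (1 + U1).det := by
    have : (1 + U1) = star z • (z • 1 + U) := by
      rw [smul_add, smul_smul, hz', one_smul]
    rw [this, det_smul]
    refine IsUnit.mul (IsUnit.pow _ ?_) hd
    exact IsUnit.of_mul_eq_one _ hz'
  set N := (1 + U1)⁻¹ with hN
  have h1 : (1 + U1) * N = 1 := mul_nonsing_inv _ hP
  have h2 : N * (1 + U1) = 1 := nonsing_inv_mul _ hP
  have hc : U1 * N = N * U1 := by
    have e1 : N + U1 * N = 1 := by rw [← h1]; noncomm_ring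
    have e2 : N + N * U1 = 1 := by rw [← h2]; noncomm_ring
    exact add_left_cancel (e1.trans e2.symm)
  -- adjoint of N
  have hNs : Nᴴ = U1 * N := by
    have e : Nᴴ * (1 + U1ᴴ) = 1 := by
      have := congrArg conjTranspose h1
      simpa using this
    calc Nᴴ = Nᴴ * ((1 + U1) * N) := by rw [h1, mul_one]
      _ = Nᴴ * ((1 + U1ᴴ) * U1 * N) := by rw [add_mul 1 U1ᴴ, hUU', one_mul, add_comm]
      _ = (Nᴴ * (1 + U1ᴴ)) * (U1 * N) := by simp only [mul_assoc]
      _ = U1 * N := by rw [e, one_mul]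
  let H : Matrix n n ℂ := (-Complex.I) • ((1 - U1) * N)
  have hIH : Complex.I • H = (1 - U1) * N := by
    simp [H, smul_smul]
  have hH : H.IsHermitian := by
    have : ((1 - U1) * N)ᴴ = - ((1 - U1) * N) := by
      rw [conjTranspose_mul, hNs, conjTranspose_sub, conjTranspose_one, hc]
      rw [mul_assoc, mul_sub U1, hUU, mul_one, sub_mul, one_mul, hc]
      noncomm_ring
    unfold Matrix.IsHermitian
    simp only [H, conjTranspose_smul, this]
    simp
  have hplus : 1 + Complex.I • H = (2 : ℂ) • N := by
    rw [hIH]; nth_rewrite 1 [← h1]; rw [← add_mul, two_smul]; noncomm_ring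
  have hminus : 1 - Complex.I • H = (2 : ℂ) • (U1 * N) := by
    rw [hIH]; nth_rewrite 1 [← h1]; rw [← sub_mul, two_smul]; noncomm_ring
  have hinv : (1 + Complex.I • H) * ((2⁻¹ : ℂ) • (1 + U1)) = 1 := by
    rw [hplus, smul_mul_smul_comm, h2]; norm_num
  set d := (1 + Complex.I • H).det with hd'
  have hdu : d ≠ 0 := by
    intro h0
    have := congrArg det hinv
    rw [det_mul, ← hd', h0] at this
    simp at this
  have hadj : adjugate (1 + Complex.I • H) = d • ((2⁻¹ : ℂ) • (1 + U1)) := by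
    have := adjugate_mul (1 + Complex.I • H)
    calc _ = adjugate (1 + Complex.I • H) * ((1 + Complex.I • H) * ((2⁻¹ : ℂ) • (1 + U1))) := by
            rw [hinv, mul_one]
      _ = _ := by rw [← mul_assoc, this, smul_mul_assoc, one_mul]
  have hcay : cay H = d • U1 := by
    rw [cay, hadj, hminus, mul_smul_comm, smul_mul_smul_comm, mul_assoc, h2]; norm_num
  refine ⟨z * d⁻¹, H, hH, ?_⟩
  rw [hcay, smul_smul, mul_assoc, inv_mul_cancel₀ hdu, hU1, smul_smul, mul_one, hz, one_smul]

abbrev Idx := Fin 3 × Fin 4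

/-- The retraction of coordinates describing the normal form. -/
def r (x : Idx × Idx) : Idx × Idx :=
  if x.1.1 = x.2.1 ∧ x.1.2 ≠ x.2.2 then ((0, x.1.2), (0, x.2.2))
  else if x.2 = (0, 0) ∧ x.1.2 = 0 then (x.2, x.1) else x

set_option maxRecDepth 100000 in
lemma r_r : ∀ x, r (r x) = r x := by decide

abbrev J := {x : Idx × Idx // r x = x}

set_option maxRecDepth 100000 in
lemma card_J : Fintype.card J = 118 := by decide

abbrev E := (Fin 3 × Fin 3 → ℝ) × (Fin 4 × Fin 4 → ℝ) × (J → ℝ)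

def T (e : E) : Matrix Idx Idx ℂ := cay (herm e.1) ⊗ₖ cay (herm e.2.1)

def W (e : E) : Matrix Idx Idx ℂ := herm fun x => e.2.2 ⟨r x, r_r x⟩

def F (e : E) : Matrix Idx Idx ℂ := T e * W e * (T e)ᴴ

/-- Entrywise smoothness. -/
def SM {X m n : Type} [NormedAddCommGroup X] [NormedSpace ℝ X] (M : X → Matrix m n ℂ) : Prop :=
  ∀ i j, ContDiff ℝ 1 fun e => M e i j

section
variable {X m n k l : Type} [NormedAddCommGroup X] [NormedSpace ℝ X]

lemma SM.mul [Fintype n] {M : X → Matrix m n ℂ} {N : X → Matrix n k ℂ} (hM : SM M) (hN : SM N) :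
    SM fun e => M e * N e := by
  intro i j
  simp only [Matrix.mul_apply]
  exact ContDiff.sum fun a _ => (hM i a).mul (hN a j)

lemma SM.kron {M : X → Matrix m n ℂ} {N : X → Matrix k l ℂ} (hM : SM M) (hN : SM N) :
    SM fun e => M e ⊗ₖ N e := by
  intro i j
  simp only [Matrix.kroneckerMap_apply]
  exact (hM _ _).mul (hN _ _)

lemma SM.ct {M : X → Matrix m n ℂ} (hM : SM M) : SM fun e => (M e)ᴴ := by
  intro i j
  simp only [Matrix.conjTranspose_apply]
  exact Complex.conjCLE.contDiff.comp (hM j i)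

lemma SM.det [Fintype n] [DecidableEq n] {M : X → Matrix n n ℂ} (hM : SM M) :
    ContDiff ℝ 1 fun e => (M e).det := by
  simp only [Matrix.det_apply]
  exact ContDiff.sum fun a _ => (contDiff_prod fun i _ => hM _ _).const_smul _

lemma SM.adj [Fintype n] [DecidableEq n] {M : X → Matrix n n ℂ} (hM : SM M) :
    SM fun e => (M e).adjugate := by
  intro i j
  simp only [Matrix.adjugate_apply]
  apply SM.det
  intro a b
  simp only [Matrix.updateRow_apply]
  split_ifs
  · exact contDiff_const
  · exact hM a b

lemma SM.herm {s : X → n × n → ℝ} (hs : ∀ x, ContDiff ℝ 1 fun e => s e x) :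
    SM fun e => herm (s e) := by
  intro i j
  simp only [Stmt11.herm, Matrix.of_apply]
  exact (Complex.ofRealCLM.contDiff.comp ((hs _).add (hs _))).add
    ((Complex.ofRealCLM.contDiff.comp ((hs _).sub (hs _))).mul contDiff_const)

lemma SM.cay [Fintype n] [DecidableEq n] {M : X → Matrix n n ℂ} (hM : SM M) :
    SM fun e => cay (M e) := by
  unfold Stmt11.cay
  refine SM.mul ?_ (SM.adj ?_)
  · intro i j
    exact contDiff_const.sub (contDiff_const.mul (hM i j))
  · intro i j
    exact contDiff_const.add (contDiff_const.mul (hM i j))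

end

lemma SM_F : SM F := by
  have hT : SM T := by
    refine SM.kron (SM.cay (SM.herm fun x => ?_)) (SM.cay (SM.herm fun x => ?_)) <;> fun_prop
  have hW : SM W := SM.herm fun x => by fun_prop
  exact (hT.mul hW).mul hT.ct

lemma contDiff_coord_F : ContDiff ℝ 1 fun e => coord (F e) := by
  rw [contDiff_pi]
  intro x
  have h := SM_F x.1 x.2
  exact ((Complex.reCLM.contDiff.comp h).add (Complex.imCLM.contDiff.comp h)).div_const 2

lemma exists_not_range : ∃ s : Idx × Idx → ℝ, ∀ e, coord (F e) ≠ s := by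
  have hd := contDiff_coord_F.dense_compl_range_of_finrank_lt_finrank (by
    simp [Module.finrank_prod, card_J])
  obtain ⟨s, hs⟩ := hd.nonempty
  exact ⟨s, fun e he => hs ⟨e, he⟩⟩

/-- Normal form reached from torus-normalised data. -/
lemma mem_range (U : Matrix (Fin 3) (Fin 3) ℂ) (V : Matrix (Fin 4) (Fin 4) ℂ)
    (Y : Matrix Idx Idx ℂ) (hU : U * Uᴴ = 1) (hV : V * Vᴴ = 1) (hY : Y.IsHermitian)
    (hdd : ∀ i a b, a ≠ b → Y (i, a) (i, b) = Y (0, a) (0, b))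
    (hre : ∀ i, (Y (i, 0) (0, 0)).im = 0) :
    ∃ e, F e = (U ⊗ₖ V) * Y * (U ⊗ₖ V)ᴴ := by
  obtain ⟨c, H, hH, rfl⟩ := exists_cay U hU
  obtain ⟨d, G, hG, rfl⟩ := exists_cay V hV
  let t : ℝ := Complex.normSq (c * d)
  let Y' : Matrix Idx Idx ℂ := (t : ℂ) • Y
  have hY' : Y'.IsHermitian := by
    unfold Matrix.IsHermitian
    simp [Y', conjTranspose_smul, hY.eq]
  refine ⟨(coord H, coord G, fun x => coord Y' x.1), ?_⟩
  have hW : W (coord H, coord G, fun x => coord Y' x.1) = Y' := by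
    have : (fun x => coord Y' (r x)) = coord Y' := by
      funext ⟨⟨i, a⟩, ⟨j, b⟩⟩
      unfold r
      split_ifs with h1 h2
      · obtain ⟨h1, h3⟩ := h1
        dsimp at h1 h3
        subst h1
        simp [coord, Y', hdd i a b h3]
      · obtain ⟨h2, h3⟩ := h2
        dsimp at h3
        obtain ⟨rfl, rfl⟩ := Prod.mk.inj h2
        subst h3
        have e1 := hre i
        have e2 := hY.apply (i, 0) (0, 0)
        have e3 := congrArg Complex.re e2
        have e4 := congrArg Complex.im e2
        simp [e1] at e3 e4
        simp [coord, Y', e1, e3, e4]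
      · rfl
    unfold W
    simp only [this]
    exact herm_coord hY'
  unfold F T
  rw [hW, herm_coord hH, herm_coord hG]
  simp only [smul_kronecker, kronecker_smul, conjTranspose_smul, Y', smul_mul_assoc,
    mul_smul_comm, smul_smul]
  congr 1
  simp only [t, Complex.star_def]
  rw [← Complex.mul_conj]
  simp only [map_mul]
  ring

lemma exists_unit_im (w : ℂ) : ∃ u : ℂ, star u * u = 1 ∧ (star u * w).im = 0 := by
  by_cases h : w = 0
  · exact ⟨1, by simp, by simp [h]⟩
  · have hn : (‖w‖ : ℂ) ≠ 0 := by simpa using h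
    have hw : star w * w = (‖w‖ : ℂ) ^ 2 := by
      rw [Complex.star_def, Complex.conj_mul']
    have hs : star (‖w‖ : ℂ) = ‖w‖ := Complex.conj_ofReal _
    refine ⟨w / ‖w‖, ?_, ?_⟩
    · rw [star_div₀, hs, div_mul_div_comm, hw]
      field_simp
    · rw [star_div₀, hs, div_mul_eq_mul_div, hw]
      have : (‖w‖ : ℂ) ^ 2 / ‖w‖ = (‖w‖ : ℂ) := by field_simp
      rw [this, Complex.ofReal_im]

lemma mem_range' (U : Matrix (Fin 3) (Fin 3) ℂ) (V : Matrix (Fin 4) (Fin 4) ℂ)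
    (Y : Matrix Idx Idx ℂ) (hU : U * Uᴴ = 1) (hV : V * Vᴴ = 1) (hY : Y.IsHermitian)
    (hdd : ∀ i a b, a ≠ b → Y (i, a) (i, b) = Y (0, a) (0, b)) :
    ∃ e, F e = (U ⊗ₖ V) * Y * (U ⊗ₖ V)ᴴ := by
  choose u hu hu2 using fun i : Fin 3 => exists_unit_im (Y (i, 0) (0, 0))
  have hY0 : (Y (0, 0) (0, 0)).im = 0 := by
    have := congrArg Complex.im (hY.apply (0, 0) (0, 0))
    simp at this
    linarith
  let v : Fin 3 → ℂ := fun i => if i = 0 then 1 else u i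
  have hv : ∀ i, star (v i) * v i = 1 := by
    intro i
    by_cases h : i = 0
    · simp [v, h]
    · simpa [v, h] using hu i
  have hv2 : ∀ i, (star (v i) * Y (i, 0) (0, 0)).im = 0 := by
    intro i
    by_cases h : i = 0
    · subst h; simpa [v] using hY0
    · simpa [v, h] using hu2 i
  have hv0 : v 0 = 1 := by simp [v]
  let D : Matrix (Fin 3) (Fin 3) ℂ := diagonal v
  have hD : D * Dᴴ = 1 := by
    simp only [D, diagonal_conjTranspose, diagonal_mul_diagonal, ← diagonal_one]
    congr 1
    funext i
    rw [Pi.star_apply, mul_comm]; exact hv i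
  let Y1 : Matrix Idx Idx ℂ := (D ⊗ₖ (1 : Matrix (Fin 4) (Fin 4) ℂ))ᴴ * Y * (D ⊗ₖ (1 : Matrix (Fin 4) (Fin 4) ℂ))
  have hDk : D ⊗ₖ (1 : Matrix (Fin 4) (Fin 4) ℂ) = diagonal fun p : Idx => v p.1 := by
    simp only [D, ← diagonal_one, diagonal_kronecker_diagonal, mul_one]
  have hY1e : ∀ p q, Y1 p q = star (v p.1) * Y p q * v q.1 := by
    intro p q
    simp only [Y1, hDk, diagonal_conjTranspose, mul_diagonal, diagonal_mul, Pi.star_apply]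
  have hY1 : Y1.IsHermitian := isHermitian_conjTranspose_mul_mul _ hY
  have hdiag : ∀ i a b, Y1 (i, a) (i, b) = Y (i, a) (i, b) := by
    intro i a b
    rw [hY1e, mul_right_comm, hv, one_mul]
  obtain ⟨e, he⟩ := mem_range (U * D) V Y1 (by
      rw [conjTranspose_mul, mul_assoc, ← mul_assoc D, hD, one_mul, hU]) hV hY1
    (fun i a b h => by rw [hdiag, hdiag, hdd i a b h])
    (fun i => by rw [hY1e, hv0, mul_one]; exact hv2 i)
  refine ⟨e, he.trans ?_⟩
  have hk : (U * D) ⊗ₖ V = (U ⊗ₖ V) * (D ⊗ₖ (1 : Matrix (Fin 4) (Fin 4) ℂ)) := by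
    rw [← mul_kronecker_mul, mul_one]
  have hQ : (D ⊗ₖ (1 : Matrix (Fin 4) (Fin 4) ℂ)) * (D ⊗ₖ (1 : Matrix (Fin 4) (Fin 4) ℂ))ᴴ = 1 := by
    rw [conjTranspose_kronecker, ← mul_kronecker_mul, hD]; simp
  rw [hk, conjTranspose_mul]
  set Q := D ⊗ₖ (1 : Matrix (Fin 4) (Fin 4) ℂ)
  calc _ = (U ⊗ₖ V) * (Q * Qᴴ) * Y * (Q * Qᴴ) * (U ⊗ₖ V)ᴴ := by
        simp only [Y1, mul_assoc]; rfl
    _ = _ := by rw [hQ, mul_one, mul_one]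

end Stmt11

theorem stmt11 :
    ∃ K₀ : Matrix (Fin 3 × Fin 4) (Fin 3 × Fin 4) ℂ, K₀.IsHermitian ∧
      blockB' K₀ = 0 ∧ blockA' K₀ = 0 ∧
      ¬ ∃ (U : Matrix (Fin 3) (Fin 3) ℂ) (V : Matrix (Fin 4) (Fin 4) ℂ)
          (Z : Matrix (Fin 3 × Fin 4) (Fin 3 × Fin 4) ℂ),
          U ∈ Matrix.specialUnitaryGroup (Fin 3) ℂ ∧
          V ∈ Matrix.specialUnitaryGroup (Fin 4) ℂ ∧
          Z.IsHermitian ∧ blockB' Z = 0 ∧ blockA' Z = 0 ∧ IsDD' Z ∧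
          K₀ = (U ⊗ₖ V) * Z * (U ⊗ₖ V)ᴴ := by
  by_contra hcon
  push Not at hcon
  obtain ⟨s, hs⟩ := Stmt11.exists_not_range
  set K := Stmt11.herm s with hK
  have hKh : K.IsHermitian := Stmt11.herm_isHermitian s
  let t : ℂ := ∑ i : Fin 3, ∑ a : Fin 4, K (i, a) (i, a)
  have ht : star t = t := by
    simp only [t, star_sum]
    refine Finset.sum_congr rfl fun i _ => Finset.sum_congr rfl fun a _ => ?_
    exact hKh.apply _ _
  let A : Matrix (Fin 3) (Fin 3) ℂ := (4⁻¹ : ℂ) • blockA' K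
  let B : Matrix (Fin 4) (Fin 4) ℂ := (3⁻¹ : ℂ) • blockB' K - (t / 12) • 1
  have hA : A.IsHermitian := by
    ext i j
    simp only [A, blockA', conjTranspose_apply, Matrix.smul_apply, of_apply, smul_eq_mul, star_mul',
      star_sum, hKh.apply]
    simp
  have hB : B.IsHermitian := by
    ext a b
    simp only [B, blockB', conjTranspose_apply, Matrix.smul_apply, Matrix.sub_apply, of_apply, smul_eq_mul,
      star_mul', star_sub, star_sum, hKh.apply, star_div₀, ht, one_apply, eq_comm (a := a)]
    split_ifs <;> simp
  let K₀ : Matrix (Fin 3 × Fin 4) (Fin 3 × Fin 4) ℂ := K - A ⊗ₖ 1 - 1 ⊗ₖ B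
  have hK₀ : K₀.IsHermitian := by
    unfold Matrix.IsHermitian
    simp only [K₀, conjTranspose_sub, conjTranspose_kronecker, conjTranspose_one, hA.eq, hB.eq,
      hKh.eq]
  have hK₀B : blockB' K₀ = 0 := by
    ext a b
    fin_cases a <;> fin_cases b <;>
    simp [K₀, A, B, t, blockA', blockB', Fin.sum_univ_succ, one_apply] <;> ring
  have hK₀A : blockA' K₀ = 0 := by
    ext i j
    fin_cases i <;> fin_cases j <;>
    simp [K₀, A, B, t, blockA', blockB', Fin.sum_univ_succ, one_apply] <;> ring
  obtain ⟨U, V, Z, hU, hV, hZ, -, -, hdd, hKZ⟩ := hcon K₀ hK₀ hK₀B hK₀A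
  have hU1 : U * Uᴴ = 1 := mem_unitaryGroup_iff.1 (mem_specialUnitaryGroup_iff.1 hU).1
  have hV1 : V * Vᴴ = 1 := mem_unitaryGroup_iff.1 (mem_specialUnitaryGroup_iff.1 hV).1
  let A1 := Uᴴ * A * U
  let B1 := Vᴴ * B * V
  have hA1 : A1.IsHermitian := isHermitian_conjTranspose_mul_mul _ hA
  have hB1 : B1.IsHermitian := isHermitian_conjTranspose_mul_mul _ hB
  have eA : U * A1 * Uᴴ = A := by
    calc _ = (U * Uᴴ) * A * (U * Uᴴ) := by simp only [A1, mul_assoc]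
      _ = A := by rw [hU1, one_mul, mul_one]
  have eB : V * B1 * Vᴴ = B := by
    calc _ = (V * Vᴴ) * B * (V * Vᴴ) := by simp only [B1, mul_assoc]
      _ = B := by rw [hV1, one_mul, mul_one]
  let Y : Matrix (Fin 3 × Fin 4) (Fin 3 × Fin 4) ℂ := Z + A1 ⊗ₖ 1 + 1 ⊗ₖ B1
  have hY : Y.IsHermitian := by
    unfold Matrix.IsHermitian
    simp only [Y, conjTranspose_add, conjTranspose_kronecker, conjTranspose_one, hA1.eq, hB1.eq,
      hZ.eq]
  obtain ⟨e, he⟩ := Stmt11.mem_range' U V Y hU1 hV1 hY (by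
    intro i a b h
    simp [Y, hdd _ a b h, one_apply, h])
  have hfin : (U ⊗ₖ V) * Y * (U ⊗ₖ V)ᴴ = K := by
    simp only [Y, mul_add, add_mul, conjTranspose_kronecker, ← mul_kronecker_mul, mul_one,
      eA, eB, hU1, hV1]
    rw [conjTranspose_kronecker] at hKZ
    rw [← hKZ]
    simp only [K₀]
    abel
  refine hs e ?_
  rw [he, hfin, hK, Stmt11.coord_herm]
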